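/- For every PDL⁻ formula φ: φ is valid on GRELst-sfinlin (the class obtained from word structures by removing the identity from the universal relation) if and only if φ is derivable in the Hilbert system H⁻ extended with the determinism axioms (Det-1) ⟨a⟩φ → [a]φ for every term variable a, and (Det-2) ⟨a⟩φ → [b]ψ for all distinct term variables a, b and all formulas φ, ψ. -/

import Mathlib

/-! Statement 16: soundness and completeness of `H⁻` + determinism axioms with
respect to the class obtained from word structures by removing the identity from
the universal relation. -/

/-- A generalized structure over term variables `A` and formula variables `P`,
with universe `W`. -/
structure GStruct (A P W : Type) where
  U : W → W → Prop
  rel : A → W → W → Prop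
  rel_sub : ∀ a x y, rel a x y → U x y
  val : P → W → Prop

/-- The universal relation is a finite linear order (on a nonempty finite universe). -/
def FinLin {A P W : Type} (S : GStruct A P W) : Prop :=
  Nonempty W ∧ Finite W ∧ (∀ x, S.U x x) ∧
    (∀ x y z, S.U x y → S.U y z → S.U x z) ∧
    (∀ x y, S.U x y → S.U y x → x = y) ∧ (∀ x y, S.U x y ∨ S.U y x)

/-- The universal relation is a finite strict linear order
(on a nonempty finite universe). -/
def SFinLin {A P W : Type} (S : GStruct A P W) : Prop :=
  Nonempty W ∧ Finite W ∧ (∀ x, ¬ S.U x x) ∧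
    (∀ x y z, S.U x y → S.U y z → S.U x z) ∧
    (∀ x y, x ≠ y → S.U x y ∨ S.U y x)
mutual
  /-- Formulas of identity-free PDL (PDL⁻). -/
  inductive MFml (A P : Type) : Type where
    | pv : P → MFml A P
    | imp : MFml A P → MFml A P → MFml A P
    | fls : MFml A P
    | box : MTrm A P → MFml A P → MFml A P
  /-- Terms of identity-free PDL (PDL⁻). -/
  inductive MTrm (A P : Type) : Type where
    | tv : A → MTrm A P
    | comp : MTrm A P → MTrm A P → MTrm A P
    | union : MTrm A P → MTrm A P → MTrm A P
    | plus : MTrm A P → MTrm A P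
    | testL : MFml A P → MTrm A P → MTrm A P
    | testR : MTrm A P → MFml A P → MTrm A P
end

namespace MFml
/-- ¬φ := φ → F -/
def neg {A P : Type} (φ : MFml A P) : MFml A P := .imp φ .fls
/-- T := ¬F -/
def tru {A P : Type} : MFml A P := neg .fls
/-- φ ∨ ψ := ¬φ → ψ -/
def or {A P : Type} (φ ψ : MFml A P) : MFml A P := .imp (neg φ) ψ
/-- φ ∧ ψ := ¬(¬φ ∨ ¬ψ) -/
def and {A P : Type} (φ ψ : MFml A P) : MFml A P := neg (or (neg φ) (neg ψ))
/-- φ ↔ ψ := (φ → ψ) ∧ (ψ → φ) -/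
def iff {A P : Type} (φ ψ : MFml A P) : MFml A P := and (.imp φ ψ) (.imp ψ φ)
/-- ⟨e⟩φ := ¬[e]¬φ -/
def dia {A P : Type} (e : MTrm A P) (φ : MFml A P) : MFml A P := neg (.box e (neg φ))
end MFml

mutual
  /-- Semantics of PDL⁻ formulas on a generalized structure. -/
  def msemF {A P W : Type} (S : GStruct A P W) : MFml A P → W → Prop
    | .pv p, x => S.val p x
    | .imp φ ψ, x => msemF S φ x → msemF S ψ x
    | .fls, _ => False
    | .box e φ, x => ∀ y, msemT S e x y → msemF S φ y
  /-- Semantics of PDL⁻ terms on a generalized structure. -/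
  def msemT {A P W : Type} (S : GStruct A P W) : MTrm A P → W → W → Prop
    | .tv a, x, y => S.rel a x y
    | .comp e f, x, z => ∃ y, msemT S e x y ∧ msemT S f y z
    | .union e f, x, y => msemT S e x y ∨ msemT S f x y
    | .plus e, x, y => Relation.TransGen (fun u v => msemT S e u v) x y
    | .testL ψ e, x, y => msemF S ψ x ∧ msemT S e x y
    | .testR e ψ, x, y => msemT S e x y ∧ msemF S ψ y
end

/-- Interpretation of term variables in the word structure `S^w`. -/
def WordRel {A : Type} (w : List A) (a : A) (i j : Fin (w.length + 1)) : Prop :=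
  (j : ℕ) = (i : ℕ) + 1 ∧ w[(i : ℕ)]? = some a

/-- Membership in GRELst-sfinlin: the structure is obtained from a word structure
(after replacing every `pˢ` by `∅`) by removing the identity from the universal
relation. -/
def StWordLike {A P W : Type} (S : GStruct A P W) : Prop :=
  ∃ (w : List A) (f : W ≃ Fin (w.length + 1)),
    (∀ x y, S.U x y ↔ f x < f y) ∧
    (∀ a x y, S.rel a x y ↔ WordRel w a (f x) (f y))

/-- Propositional formulas over variables `V`. -/
inductive PropF (V : Type) : Type where
  | pv : V → PropF V
  | imp : PropF V → PropF V → PropF V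
  | fls : PropF V

/-- Evaluation of a propositional formula under a valuation. -/
def PropF.eval {V : Type} (v : V → Prop) : PropF V → Prop
  | .pv p => v p
  | .imp a b => PropF.eval v a → PropF.eval v b
  | .fls => False

/-- Substitution instance of a propositional formula, substituting PDL⁻ formulas
for the propositional variables. -/
def PropF.inst {V A P : Type} (σ : V → MFml A P) : PropF V → MFml A P
  | .pv p => σ p
  | .imp a b => .imp (PropF.inst σ a) (PropF.inst σ b)
  | .fls => .fls

/-- The Hilbert system `H⁻` extended with the determinism axioms (Det-1), (Det-2). -/
inductive MProofDet {A P : Type} : MFml A P → Prop where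
  /-- modus ponens -/
  | mp {φ ψ : MFml A P} : MProofDet φ → MProofDet (.imp φ ψ) → MProofDet ψ
  /-- necessitation -/
  | nec {φ : MFml A P} (e : MTrm A P) : MProofDet φ → MProofDet (.box e φ)
  /-- (Prop): all substitution-instances of valid propositional formulas -/
  | prop {V : Type} (χ : PropF V) (hval : ∀ v, PropF.eval v χ) (σ : V → MFml A P) :
      MProofDet (PropF.inst σ χ)
  /-- (;) -/
  | compAx (e f : MTrm A P) (φ : MFml A P) :
      MProofDet (MFml.iff (.box (.comp e f) φ) (.box e (.box f φ)))
  /-- (+) -/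
  | unionAx (e f : MTrm A P) (φ : MFml A P) :
      MProofDet (MFml.iff (.box (.union e f) φ) (MFml.and (.box e φ) (.box f φ)))
  /-- (⁺) -/
  | plusAx (e : MTrm A P) (φ : MFml A P) :
      MProofDet (MFml.iff (.box (.plus e) φ) (MFml.and (.box e φ) (.box e (.box (.plus e) φ))))
  /-- (⁺-Ind) -/
  | plusInd (e : MTrm A P) (φ : MFml A P) :
      MProofDet (.imp (MFml.and (.box e φ) (.box (.plus e) (.imp φ (.box e φ)))) (.box (.plus e) φ))
  /-- (?-L) -/
  | testLAx (ψ : MFml A P) (e : MTrm A P) (φ : MFml A P) :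
      MProofDet (MFml.iff (.box (.testL ψ e) φ) (.imp ψ (.box e φ)))
  /-- (?-R) -/
  | testRAx (e : MTrm A P) (ψ φ : MFml A P) :
      MProofDet (MFml.iff (.box (.testR e ψ) φ) (.box e (.imp ψ φ)))
  /-- (K) -/
  | kAx (e : MTrm A P) (φ ψ : MFml A P) :
      MProofDet (.imp (.box e (.imp φ ψ)) (.imp (.box e φ) (.box e ψ)))
  /-- (Löb-⁺) -/
  | loeb (e : MTrm A P) (φ : MFml A P) :
      MProofDet (.imp (.box (.plus e) (.imp (.box (.plus e) φ) φ)) (.box (.plus e) φ))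
  /-- (Det-1): ⟨a⟩φ → [a]φ -/
  | det1 (a : A) (φ : MFml A P) :
      MProofDet (.imp (MFml.dia (.tv a) φ) (.box (.tv a) φ))
  /-- (Det-2): ⟨a⟩φ → [b]ψ for distinct term variables a ≠ b -/
  | det2 (a b : A) (hab : a ≠ b) (φ ψ : MFml A P) :
      MProofDet (.imp (MFml.dia (.tv a) φ) (.box (.tv b) ψ))

section IdentityFreePDL

variable {A P : Type}

/-! ### Soundness -/

section Soundness

variable {W : Type} {S : GStruct A P W}

theorem msemF_and (φ ψ : MFml A P) (x : W) :
    msemF S (MFml.and φ ψ) x ↔ msemF S φ x ∧ msemF S ψ x := by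
  simp only [MFml.and, MFml.or, MFml.neg, msemF]
  tauto

theorem msemF_iff (φ ψ : MFml A P) (x : W) :
    msemF S (MFml.iff φ ψ) x ↔ (msemF S φ x ↔ msemF S ψ x) := by
  simp only [MFml.iff, msemF_and, msemF]
  tauto

theorem msemF_dia (e : MTrm A P) (φ : MFml A P) (x : W) :
    msemF S (MFml.dia e φ) x ↔ ∃ y, msemT S e x y ∧ msemF S φ y := by
  simp only [MFml.dia, MFml.neg, msemF]
  constructor
  · intro h
    by_contra! hc
    exact h fun y hy hφ => hc y hy hφ
  · rintro ⟨y, hy, hφ⟩ h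
    exact h y hy hφ

theorem msemF_inst {V : Type} (σ : V → MFml A P) (x : W) :
    ∀ χ : PropF V, msemF S (PropF.inst σ χ) x ↔ PropF.eval (fun v => msemF S (σ v) x) χ
  | .pv _ => Iff.rfl
  | .imp a b => by
      simp only [PropF.inst, PropF.eval, msemF, msemF_inst σ x a, msemF_inst σ x b]
  | .fls => Iff.rfl

/-- If every letter strictly increases a rank, then so does every term: no term relates a point
to itself. -/
theorem lt_of_msemT {r : W → ℕ} (hr : ∀ a x y, S.rel a x y → r x < r y) :
    ∀ (e : MTrm A P) {x y : W}, msemT S e x y → r x < r y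
  | .tv a, x, y, h => hr a x y (by simpa only [msemT] using h)
  | .comp e f, x, y, h => by
      simp only [msemT] at h
      obtain ⟨z, h₁, h₂⟩ := h
      exact (lt_of_msemT hr e h₁).trans (lt_of_msemT hr f h₂)
  | .union e f, x, y, h => by
      simp only [msemT] at h
      exact h.elim (lt_of_msemT hr e) (lt_of_msemT hr f)
  | .plus e, x, y, h => by
      simp only [msemT] at h
      induction h with
      | single h => exact lt_of_msemT hr e h
      | tail _ h ih => exact ih.trans (lt_of_msemT hr e h)
  | .testL ψ e, x, y, h => by
      simp only [msemT] at h
      exact lt_of_msemT hr e h.2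
  | .testR e ψ, x, y, h => by
      simp only [msemT] at h
      exact lt_of_msemT hr e h.1
termination_by e => sizeOf e

theorem msemF_plus_iff (e : MTrm A P) (φ : MFml A P) (x : W) :
    msemF S (.box (.plus e) φ) x ↔
      msemF S (.box e φ) x ∧ msemF S (.box e (.box (.plus e) φ)) x := by
  simp only [msemF, msemT]
  constructor
  · exact fun h => ⟨fun y hy => h y (.single hy), fun y hy z hz => h z (.head hy hz)⟩
  · rintro ⟨h₁, h₂⟩ y hy
    rcases Relation.TransGen.head'_iff.1 hy with ⟨z, hz, hzy⟩
    rcases Relation.reflTransGen_iff_eq_or_transGen.1 hzy with rfl | h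
    · exact h₁ _ hz
    · exact h₂ z hz y h

theorem msemF_of_mProofDet (hS : StWordLike S) {φ : MFml A P} (h : MProofDet φ) :
    ∀ x : W, msemF S φ x := by
  obtain ⟨w, f, -, hrel⟩ := hS
  have hlt : ∀ (e : MTrm A P) {x y : W}, msemT S e x y → (f x : ℕ) < f y :=
    lt_of_msemT (r := fun x => (f x : ℕ)) fun a x y h => by
      have := ((hrel a x y).1 h).1
      omega
  induction h with
  | mp _ _ ih₁ ih₂ => exact fun x => by simpa only [msemF, ih₁ x, true_imp_iff] using ih₂ x
  | nec e _ ih => exact fun x => by simpa only [msemF] using fun y _ => ih y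
  | prop χ hval σ => exact fun x => (msemF_inst σ x χ).2 (hval _)
  | compAx e f φ =>
    intro x
    simp only [msemF_iff, msemF, msemT]
    exact ⟨fun h y hy z hz => h z ⟨y, hy, hz⟩, fun h z ⟨y, hy, hz⟩ => h y hy z hz⟩
  | unionAx e f φ =>
    intro x
    simp only [msemF_iff, msemF_and, msemF, msemT]
    exact ⟨fun h => ⟨fun y hy => h y (.inl hy), fun y hy => h y (.inr hy)⟩,
      fun h y hy => hy.elim (h.1 y) (h.2 y)⟩
  | plusAx e φ =>
    intro x
    rw [msemF_iff, msemF_and]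
    exact msemF_plus_iff e φ x
  | plusInd e φ =>
    intro x
    simp only [msemF_and, msemF, msemT]
    rintro ⟨h₁, h₂⟩ y hy
    induction hy with
    | single h => exact h₁ _ h
    | tail h h' ih => exact h₂ _ h ih _ h'
  | testLAx ψ e φ =>
    intro x
    simp only [msemF_iff, msemF, msemT]
    exact ⟨fun h hx y hy => h y ⟨hx, hy⟩, fun h y hy => h hy.1 y hy.2⟩
  | testRAx e ψ φ =>
    intro x
    simp only [msemF_iff, msemF, msemT]
    exact ⟨fun h y hy hψ => h y ⟨hy, hψ⟩, fun h y hy => h y hy.1 hy.2⟩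
  | kAx e φ ψ =>
    intro x
    simp only [msemF]
    exact fun h₁ h₂ y hy => h₁ y hy (h₂ y hy)
  | loeb e φ =>
    intro x
    simp only [msemF]
    intro h
    have key : ∀ n y, w.length - (f y : ℕ) = n → msemT S (.plus e) x y → msemF S φ y := by
      intro n
      induction n using Nat.strong_induction_on with
      | _ n ih =>
        intro y hn hy
        refine h y hy fun z hz => ih _ ?_ z rfl ?_
        · have := hlt _ hz
          have := (f z).isLt
          omega
        · simp only [msemT] at hy hz ⊢
          exact hy.trans hz
    exact fun y hy => key _ y rfl hy
  | det1 a φ =>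
    intro x
    simp only [msemF, msemF_dia, msemT]
    rintro ⟨y, hy, hφ⟩ z hz
    have h₁ := ((hrel a x y).1 hy).1
    have h₂ := ((hrel a x z).1 hz).1
    rwa [show z = y from f.injective (Fin.ext (h₂.trans h₁.symm))]
  | det2 a b hab φ ψ =>
    intro x
    simp only [msemF, msemF_dia, msemT]
    rintro ⟨y, hy, -⟩ z hz
    have h₁ := ((hrel a x y).1 hy).2
    have h₂ := ((hrel b x z).1 hz).2
    exact absurd (Option.some.inj (h₁.symm.trans h₂)) hab

end Soundness

/-! ### Maximal consistent sets -/

/-- Derivability from a set of assumptions, which are not subject to necessitation. -/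
inductive DerivesFrom (T : Set (MFml A P)) : MFml A P → Prop where
  | assumption {φ : MFml A P} : φ ∈ T → DerivesFrom T φ
  | of_proof {φ : MFml A P} : MProofDet φ → DerivesFrom T φ
  | mp {φ ψ : MFml A P} : DerivesFrom T φ → DerivesFrom T (.imp φ ψ) → DerivesFrom T ψ

/-- Maximal consistent sets of formulas. -/
structure IsMCS (Γ : Set (MFml A P)) : Prop where
  of_proof : ∀ {φ}, MProofDet φ → φ ∈ Γ
  mp : ∀ {φ ψ}, .imp φ ψ ∈ Γ → φ ∈ Γ → ψ ∈ Γ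
  fls_notMem : MFml.fls ∉ Γ
  mem_or_neg_mem : ∀ φ, φ ∈ Γ ∨ φ.neg ∈ Γ

namespace MProofDet

theorem imp_intro (φ ψ : MFml A P) : MProofDet (.imp φ (.imp ψ φ)) :=
  prop (V := MFml A P) (.imp (.pv φ) (.imp (.pv ψ) (.pv φ)))
    (fun v => by simp only [PropF.eval]; tauto) id

theorem imp_distrib (φ ψ χ : MFml A P) :
    MProofDet (.imp (.imp φ (.imp ψ χ)) (.imp (.imp φ ψ) (.imp φ χ))) :=
  prop (V := MFml A P)
    (.imp (.imp (.pv φ) (.imp (.pv ψ) (.pv χ)))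
      (.imp (.imp (.pv φ) (.pv ψ)) (.imp (.pv φ) (.pv χ))))
    (fun v => by simp only [PropF.eval]; tauto) id

theorem imp_self (φ : MFml A P) : MProofDet (.imp φ φ) :=
  prop (V := MFml A P) (.imp (.pv φ) (.pv φ)) (fun v => by simp only [PropF.eval]; tauto) id

theorem fls_elim (φ : MFml A P) : MProofDet (.imp .fls φ) :=
  prop (V := MFml A P) (.imp .fls (.pv φ)) (fun v => by simp only [PropF.eval]; tauto) id

theorem neg_neg_elim (φ : MFml A P) : MProofDet (.imp φ.neg.neg φ) :=
  prop (V := MFml A P) (.imp (.imp (.imp (.pv φ) .fls) .fls) (.pv φ))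
    (fun v => by simp only [PropF.eval]; tauto) id

end MProofDet

namespace DerivesFrom

theorem deduction {T : Set (MFml A P)} {φ ψ : MFml A P} (h : DerivesFrom (insert φ T) ψ) :
    DerivesFrom T (.imp φ ψ) := by
  induction h with
  | assumption h =>
    rcases h with rfl | h
    · exact .of_proof (.imp_self _)
    · exact .mp (.assumption h) (.of_proof (.imp_intro _ _))
  | of_proof h => exact .mp (.of_proof h) (.of_proof (.imp_intro _ _))
  | mp _ _ ih₁ ih₂ => exact .mp ih₁ (.mp ih₂ (.of_proof (.imp_distrib _ _ _)))

theorem mono {T T' : Set (MFml A P)} (hT : T ⊆ T') {φ : MFml A P} (h : DerivesFrom T φ) :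
    DerivesFrom T' φ := by
  induction h with
  | assumption h => exact .assumption (hT h)
  | of_proof h => exact .of_proof h
  | mp _ _ ih₁ ih₂ => exact .mp ih₁ ih₂

theorem mProofDet {φ : MFml A P} (h : DerivesFrom ∅ φ) : MProofDet φ := by
  induction h with
  | assumption h => exact absurd h (Set.notMem_empty _)
  | of_proof h => exact h
  | mp _ _ ih₁ ih₂ => exact .mp ih₁ ih₂

theorem exists_of_sUnion {c : Set (Set (MFml A P))} (hc : IsChain (· ⊆ ·) c) (hne : c.Nonempty)
    {φ : MFml A P} (h : DerivesFrom (⋃₀ c) φ) : ∃ T ∈ c, DerivesFrom T φ := by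
  induction h with
  | assumption h =>
    obtain ⟨T, hT, hφ⟩ := h
    exact ⟨T, hT, .assumption hφ⟩
  | of_proof h => exact hne.imp fun T hT => ⟨hT, .of_proof h⟩
  | mp _ _ ih₁ ih₂ =>
    obtain ⟨T₁, hT₁, h₁⟩ := ih₁
    obtain ⟨T₂, hT₂, h₂⟩ := ih₂
    rcases hc.total hT₁ hT₂ with h | h
    · exact ⟨T₂, hT₂, .mp (h₁.mono h) h₂⟩
    · exact ⟨T₁, hT₁, .mp h₁ (h₂.mono h)⟩

end DerivesFrom

namespace IsMCS

/-- The Lindenbaum lemma. -/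
theorem exists_superset {T : Set (MFml A P)} (hT : ¬ DerivesFrom T .fls) :
    ∃ Γ, IsMCS Γ ∧ T ⊆ Γ := by
  obtain ⟨Γ, hTΓ, hΓ⟩ := zorn_subset_nonempty {T : Set (MFml A P) | ¬ DerivesFrom T .fls}
    (fun c hc hchain hne => ⟨⋃₀ c, fun h => by
      obtain ⟨T, hT, h⟩ := DerivesFrom.exists_of_sUnion hchain hne h
      exact hc hT h, fun s hs => Set.subset_sUnion_of_mem hs⟩) T hT
  have hcons : ¬ DerivesFrom Γ .fls := hΓ.prop
  have hneg : ∀ {φ}, φ ∉ Γ → DerivesFrom Γ φ.neg := fun {φ} hφ => by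
    by_contra hc
    exact hφ (hΓ.le_of_ge (y := insert φ Γ) (fun h => hc h.deduction) (Set.subset_insert _ _)
      (Set.mem_insert _ _))
  have hder : ∀ {φ}, DerivesFrom Γ φ → φ ∈ Γ := fun {φ} h => by
    by_contra hφ
    exact hcons (.mp h (hneg hφ))
  refine ⟨Γ, ⟨fun h => hder (.of_proof h),
    fun h₁ h₂ => hder (.mp (.assumption h₂) (.assumption h₁)),
    fun h => hcons (.assumption h), fun φ => ?_⟩, hTΓ⟩
  by_cases h : φ ∈ Γ
  · exact .inl h
  · exact .inr (hder (hneg h))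

theorem mProofDet_of_forall {φ : MFml A P} (h : ∀ Γ, IsMCS Γ → φ ∈ Γ) : MProofDet φ := by
  by_contra hφ
  obtain ⟨Γ, hΓ, hsub⟩ := exists_superset (T := {φ.neg}) fun hd =>
    hφ (.mp (DerivesFrom.mProofDet (DerivesFrom.deduction (by simpa using hd))) (.neg_neg_elim φ))
  exact hΓ.fls_notMem (hΓ.mp (hsub rfl) (h Γ hΓ))

theorem neg_mem {Γ : Set (MFml A P)} (hΓ : IsMCS Γ) {φ : MFml A P} : φ.neg ∈ Γ ↔ φ ∉ Γ :=
  ⟨fun h₁ h₂ => hΓ.fls_notMem (hΓ.mp h₁ h₂), (hΓ.mem_or_neg_mem φ).resolve_left⟩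

theorem imp_mem {Γ : Set (MFml A P)} (hΓ : IsMCS Γ)
    {φ ψ : MFml A P} : MFml.imp φ ψ ∈ Γ ↔ (φ ∈ Γ → ψ ∈ Γ) := by
  refine ⟨hΓ.mp, fun h => ?_⟩
  by_cases hφ : φ ∈ Γ
  · exact hΓ.mp (hΓ.of_proof (.imp_intro _ _)) (h hφ)
  · exact hΓ.mp (hΓ.mp (hΓ.of_proof (.imp_distrib _ _ _))
      (hΓ.mp (hΓ.of_proof (.imp_intro _ _)) (hΓ.of_proof (.fls_elim ψ)))) (hΓ.neg_mem.2 hφ)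

theorem and_mem {Γ : Set (MFml A P)} (hΓ : IsMCS Γ)
    {φ ψ : MFml A P} : MFml.and φ ψ ∈ Γ ↔ φ ∈ Γ ∧ ψ ∈ Γ := by
  simp only [MFml.and, MFml.or, hΓ.neg_mem, hΓ.imp_mem]
  tauto

theorem iff_mem {Γ : Set (MFml A P)} (hΓ : IsMCS Γ)
    {φ ψ : MFml A P} : MFml.iff φ ψ ∈ Γ ↔ (φ ∈ Γ ↔ ψ ∈ Γ) := by
  simp only [MFml.iff, hΓ.and_mem, hΓ.imp_mem]
  tauto

theorem tru_mem {Γ : Set (MFml A P)} (hΓ : IsMCS Γ) : MFml.tru ∈ Γ := hΓ.neg_mem.2 hΓ.fls_notMem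

theorem box_mono {Γ : Set (MFml A P)} (hΓ : IsMCS Γ)
    {e : MTrm A P} {φ ψ : MFml A P} (h : ∀ Δ, IsMCS Δ → φ ∈ Δ → ψ ∈ Δ)
    (hφ : .box e φ ∈ Γ) : .box e ψ ∈ Γ :=
  hΓ.mp (hΓ.mp (hΓ.of_proof (.kAx e φ ψ)) (hΓ.of_proof
    (.nec e (mProofDet_of_forall fun Δ hΔ => hΔ.imp_mem.2 (h Δ hΔ))))) hφ

theorem box_and {Γ : Set (MFml A P)} (hΓ : IsMCS Γ)
    {e : MTrm A P} {φ ψ : MFml A P} (hφ : .box e φ ∈ Γ) (hψ : .box e ψ ∈ Γ) :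
    .box e (.and φ ψ) ∈ Γ :=
  hΓ.mp (hΓ.mp (hΓ.of_proof (.kAx e ψ _)) (hΓ.box_mono
    (fun _ hΔ h => hΔ.imp_mem.2 fun h' => hΔ.and_mem.2 ⟨h, h'⟩) hφ)) hψ

theorem box_comp {Γ : Set (MFml A P)} (hΓ : IsMCS Γ) {e f : MTrm A P} {φ : MFml A P} :
    .box (.comp e f) φ ∈ Γ ↔ .box e (.box f φ) ∈ Γ :=
  hΓ.iff_mem.1 (hΓ.of_proof (.compAx e f φ))

theorem box_union {Γ : Set (MFml A P)} (hΓ : IsMCS Γ) {e f : MTrm A P} {φ : MFml A P} :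
    .box (.union e f) φ ∈ Γ ↔ .box e φ ∈ Γ ∧ .box f φ ∈ Γ :=
  (hΓ.iff_mem.1 (hΓ.of_proof (.unionAx e f φ))).trans hΓ.and_mem

theorem box_plus {Γ : Set (MFml A P)} (hΓ : IsMCS Γ) {e : MTrm A P} {φ : MFml A P} :
    .box (.plus e) φ ∈ Γ ↔ .box e φ ∈ Γ ∧ .box e (.box (.plus e) φ) ∈ Γ :=
  (hΓ.iff_mem.1 (hΓ.of_proof (.plusAx e φ))).trans hΓ.and_mem

theorem box_testL {Γ : Set (MFml A P)} (hΓ : IsMCS Γ) {ψ : MFml A P} {e : MTrm A P} {φ : MFml A P} :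
    .box (.testL ψ e) φ ∈ Γ ↔ (ψ ∈ Γ → .box e φ ∈ Γ) :=
  (hΓ.iff_mem.1 (hΓ.of_proof (.testLAx ψ e φ))).trans hΓ.imp_mem

theorem box_testR {Γ : Set (MFml A P)} (hΓ : IsMCS Γ) {e : MTrm A P} {ψ φ : MFml A P} :
    .box (.testR e ψ) φ ∈ Γ ↔ .box e (.imp ψ φ) ∈ Γ :=
  hΓ.iff_mem.1 (hΓ.of_proof (.testRAx e ψ φ))

theorem box_plus_box_plus {Γ : Set (MFml A P)} (hΓ : IsMCS Γ)
    {e : MTrm A P} {φ : MFml A P} (h : .box (.plus e) φ ∈ Γ) :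
    .box (.plus e) (.box (.plus e) φ) ∈ Γ :=
  hΓ.mp (hΓ.of_proof (.plusInd e _)) (hΓ.and_mem.2 ⟨(hΓ.box_plus.1 h).2,
    hΓ.of_proof (.nec _ (mProofDet_of_forall fun _ hΔ =>
      hΔ.imp_mem.2 fun h => (hΔ.box_plus.1 h).2))⟩)

/-- By the Löb principle, a satisfiable formula has a last occurrence along `e⁺`. -/
theorem exists_last {Γ : Set (MFml A P)} (hΓ : IsMCS Γ) (e : MTrm A P) {φ : MFml A P} (hφ : φ ∈ Γ) :
    ∃ Δ, IsMCS Δ ∧ φ ∈ Δ ∧ .box (.plus e) φ.neg ∈ Δ := by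
  by_contra! hc
  have himp : MProofDet (.imp (.box (.plus e) φ.neg) φ.neg) := mProofDet_of_forall fun Δ hΔ =>
    hΔ.imp_mem.2 fun h => hΔ.neg_mem.2 fun h' => hc Δ hΔ h' h
  exact hΓ.neg_mem.1 (hΓ.of_proof (.mp (.mp (.nec _ himp) (.loeb e φ.neg)) himp)) hφ

theorem letter_successor {Γ : Set (MFml A P)} (hΓ : IsMCS Γ) {a : A} (ha : .box (.tv a) .fls ∉ Γ) :
    IsMCS {χ : MFml A P | .box (.tv a) χ ∈ Γ} where
  of_proof h := hΓ.of_proof (.nec _ h)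
  mp h₁ h₂ := hΓ.mp (hΓ.mp (hΓ.of_proof (.kAx _ _ _)) h₁) h₂
  fls_notMem := ha
  mem_or_neg_mem φ := by
    have h := hΓ.imp_mem.1 (hΓ.of_proof (.det1 a φ))
    rw [MFml.dia, hΓ.neg_mem] at h
    exact (em _).symm.imp_left h

theorem box_mem_of_ne {Γ : Set (MFml A P)} (hΓ : IsMCS Γ)
    {a b : A} (hab : a ≠ b) (ha : .box (.tv a) .fls ∉ Γ) (ψ : MFml A P) :
    .box (.tv b) ψ ∈ Γ := by
  refine hΓ.mp (hΓ.of_proof (.det2 a b hab .tru ψ)) (hΓ.neg_mem.2 fun h => ha ?_)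
  exact hΓ.box_mono (fun Δ hΔ h => absurd hΔ.tru_mem (hΔ.neg_mem.1 h)) h

/-- The restriction of `Γ` to finitely many formulas is described by a single formula. -/
theorem exists_characteristic (Γ : Set (MFml A P)) (L : List (MFml A P)) :
    ∃ t : MFml A P, ∀ Δ, IsMCS Δ → (t ∈ Δ ↔ ∀ χ ∈ L, (χ ∈ Δ ↔ χ ∈ Γ)) := by
  induction L with
  | nil => exact ⟨.tru, fun Δ hΔ => by simp [hΔ.tru_mem]⟩
  | cons χ L ih =>
    obtain ⟨t, ht⟩ := ih
    by_cases hχ : χ ∈ Γ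
    · exact ⟨.and χ t, fun Δ hΔ => by simp [hΔ.and_mem, ht Δ hΔ, hχ]⟩
    · exact ⟨.and χ.neg t, fun Δ hΔ => by simp [hΔ.and_mem, hΔ.neg_mem, ht Δ hΔ, hχ]⟩

end IsMCS

theorem exists_sum_of_letters (a₀ : A) (l : List A) :
    ∃ σ : MTrm A P, ∀ Γ, IsMCS Γ → ∀ φ, .box σ φ ∈ Γ → ∀ a ∈ l, .box (.tv a) φ ∈ Γ := by
  induction l with
  | nil => exact ⟨.tv a₀, by simp⟩
  | cons a l ih =>
    obtain ⟨σ, hσ⟩ := ih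
    refine ⟨.union (.tv a) σ, fun Γ hΓ φ h b hb => ?_⟩
    obtain ⟨h₁, h₂⟩ := hΓ.box_union.1 h
    rcases List.mem_cons.1 hb with rfl | hb
    · exact h₁
    · exact hσ Γ hΓ φ h₂ b hb

/-! ### Words labelled by maximal consistent sets -/

/-- The positions of the word `w` are labelled by maximal consistent sets that agree with the
transitions of `w` as far as the letters in `l` and the formulas in `L` are concerned. -/
structure IsLabelling (l : List A) (L : List (MFml A P)) (w : List A)
    (Γ : ℕ → Set (MFml A P)) : Prop where
  isMCS : ∀ i, IsMCS (Γ i)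
  box_mem : ∀ i ≤ w.length, ∀ a ∈ l, ∀ χ ∈ L,
    (.box (.tv a) χ ∈ Γ i ↔ (w[i]? = some a → χ ∈ Γ (i + 1)))

/-- The members of `L` that belong to `Γ`. -/
def atomOf (L : List (MFml A P)) (Γ : Set (MFml A P)) : Set {χ // χ ∈ L} := {χ | χ.1 ∈ Γ}

theorem atomOf_eq_iff {L : List (MFml A P)} {Γ Δ : Set (MFml A P)} :
    atomOf L Δ = atomOf L Γ ↔ ∀ χ ∈ L, (χ ∈ Δ ↔ χ ∈ Γ) := by
  simp [atomOf, Set.ext_iff]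

/-- `T` collects the atoms that no longer occur in the future; every letter of the word under
construction adds one of the finitely many atoms to `T`. -/
theorem exists_labelling_of_excluded {l : List A} {L : List (MFml A P)} {σ : MTrm A P}
    (hσ : ∀ Γ, IsMCS Γ → ∀ φ, .box σ φ ∈ Γ → ∀ a ∈ l, .box (.tv a) φ ∈ Γ)
    (T : Set (Set {χ // χ ∈ L})) :
    ∀ (D : MFml A P) (Γ : Set (MFml A P)), IsMCS Γ →
      (∀ Δ, IsMCS Δ → D ∈ Δ → atomOf L Δ ∉ T) → .box (.plus σ) D ∈ Γ → atomOf L Γ ∉ T →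
      ∃ w Γs, IsLabelling l L w Γs ∧ ∀ χ ∈ L, (χ ∈ Γs 0 ↔ χ ∈ Γ) := by
  have : Finite {χ // χ ∈ L} := (List.finite_toSet L).to_subtype
  induction T using WellFoundedGT.induction with
  | _ T ih =>
    intro D Γ hΓ hD hDΓ hT
    obtain ⟨t, ht⟩ := IsMCS.exists_characteristic Γ L
    obtain ⟨Γ', hΓ', hmem, hlast⟩ := hΓ.exists_last σ
      (hΓ.and_mem.2 ⟨(ht Γ hΓ).2 fun _ _ => Iff.rfl, hDΓ⟩)
    obtain ⟨htΓ', hDΓ'⟩ := hΓ'.and_mem.1 hmem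
    have hagree := (ht Γ' hΓ').1 htΓ'
    by_cases hnosucc : ∀ a ∈ l, .box (.tv a) .fls ∈ Γ'
    · refine ⟨[], fun _ => Γ', ⟨fun _ => hΓ', fun i _ a ha χ _ => ?_⟩, hagree⟩
      simpa using hΓ'.box_mono (fun Δ hΔ h => absurd h hΔ.fls_notMem) (hnosucc a ha)
    push Not at hnosucc
    obtain ⟨a, hal, ha⟩ := hnosucc
    have hΔ := hΓ'.letter_successor ha
    have hD' : .box (.plus σ) (.and D t.neg) ∈ Γ' := by
      refine hΓ'.box_mono (fun Δ hΔ h => ?_)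
        (hΓ'.box_and (hΓ'.box_and hlast (hΓ'.box_plus_box_plus hDΓ')) hDΓ')
      simp only [hΔ.and_mem, hΔ.neg_mem] at h ⊢
      tauto
    have hexcl : ∀ Δ, IsMCS Δ → .and D t.neg ∈ Δ → atomOf L Δ ∉ insert (atomOf L Γ) T := by
      intro Δ hΔ h
      rw [hΔ.and_mem, hΔ.neg_mem, ht Δ hΔ, ← atomOf_eq_iff] at h
      exact fun hm => hm.elim h.2 (hD Δ hΔ h.1)
    obtain ⟨h₁, h₂⟩ := hΓ'.box_plus.1 hD'
    obtain ⟨w, Γs, hΓs, h0⟩ := ih (insert (atomOf L Γ) T) (Set.ssubset_insert hT) _ _ hΔ hexcl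
      (hσ Γ' hΓ' _ h₂ a hal) (hexcl _ hΔ (hσ Γ' hΓ' _ h₁ a hal))
    refine ⟨a :: w, fun i => Nat.casesOn i Γ' Γs, ⟨?_, ?_⟩, hagree⟩
    · rintro (_ | i)
      exacts [hΓ', hΓs.isMCS i]
    · rintro (_ | i) hi b hb χ hχ
      · by_cases hab : a = b
        · subst hab
          simpa using (h0 χ hχ).symm
        · simp [hab, hΓ'.box_mem_of_ne hab ha χ]
      · simpa using hΓs.box_mem i (by simpa using hi) b hb χ hχ

theorem IsMCS.exists_labelling {Γ : Set (MFml A P)} (hΓ : IsMCS Γ) (l : List A)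
    (L : List (MFml A P)) :
    ∃ w Γs, IsLabelling l L w Γs ∧ ∀ χ ∈ L, (χ ∈ Γs 0 ↔ χ ∈ Γ) := by
  rcases l with _ | ⟨a, l⟩
  · exact ⟨[], fun _ => Γ, ⟨fun _ => hΓ, by simp⟩, fun _ _ => Iff.rfl⟩
  · obtain ⟨σ, hσ⟩ := exists_sum_of_letters (P := P) a (a :: l)
    exact exists_labelling_of_excluded hσ ∅ .tru Γ hΓ (fun _ _ _ => Set.notMem_empty _)
      (hΓ.of_proof (.nec _ (.imp_self _))) (Set.notMem_empty _)

/-! ### The truth lemma -/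

mutual
  /-- The instances `[a]χ` to which evaluating a formula reduces, as pairs `(a, χ)`. -/
  def MFml.letterBoxes : MFml A P → List (A × MFml A P)
    | .pv _ => []
    | .imp φ ψ => φ.letterBoxes ++ ψ.letterBoxes
    | .fls => []
    | .box e φ => φ.letterBoxes ++ e.letterBoxes φ
  /-- The instances `[a]χ` to which evaluating `[e]φ` reduces, given the truth of `φ`. -/
  def MTrm.letterBoxes : MTrm A P → MFml A P → List (A × MFml A P)
    | .tv a, φ => [(a, φ)]
    | .comp e f, φ => e.letterBoxes (.box f φ) ++ f.letterBoxes φ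
    | .union e f, φ => e.letterBoxes φ ++ f.letterBoxes φ
    | .plus e, φ => e.letterBoxes φ ++ e.letterBoxes (.box (.plus e) φ)
    | .testL ψ e, φ => ψ.letterBoxes ++ e.letterBoxes φ
    | .testR e ψ, φ => ψ.letterBoxes ++ e.letterBoxes (.imp ψ φ)
end

/-- The word structure of `w` in which formula variables are read off a labelling. -/
def labelledWord (w : List A) (Γ : ℕ → Set (MFml A P)) : GStruct A P (Fin (w.length + 1)) where
  U i j := i < j
  rel := WordRel w
  rel_sub a i j h := Fin.lt_def.2 (by have := h.1; omega)
  val p i := .pv p ∈ Γ i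

section Truth

variable {l : List A} {L : List (MFml A P)} {w : List A} {Γ : ℕ → Set (MFml A P)}

mutual
  theorem mem_iff_msemF (h : IsLabelling l L w Γ) : ∀ φ : MFml A P,
      (∀ q ∈ φ.letterBoxes, q.1 ∈ l ∧ q.2 ∈ L) →
      ∀ i : Fin (w.length + 1), φ ∈ Γ i ↔ msemF (labelledWord w Γ) φ i
    | .pv p, _, i => by simp only [msemF, labelledWord]
    | .imp φ ψ, hq, i => by
        simp only [MFml.letterBoxes, List.forall_mem_append] at hq
        rw [(h.isMCS i).imp_mem, mem_iff_msemF h φ hq.1, mem_iff_msemF h ψ hq.2, msemF]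
    | .fls, _, i => by simp only [msemF, (h.isMCS i).fls_notMem]
    | .box e φ, hq, i => by
        simp only [MFml.letterBoxes, List.forall_mem_append] at hq
        rw [box_mem_iff h e φ hq.2, msemF]
        exact forall₂_congr fun j _ => mem_iff_msemF h φ hq.1 j
  theorem box_mem_iff (h : IsLabelling l L w Γ) : ∀ (e : MTrm A P) (φ : MFml A P),
      (∀ q ∈ e.letterBoxes φ, q.1 ∈ l ∧ q.2 ∈ L) →
      ∀ i : Fin (w.length + 1),
        .box e φ ∈ Γ i ↔ ∀ j : Fin (w.length + 1), msemT (labelledWord w Γ) e i j → φ ∈ Γ j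
    | .tv a, φ, hq, i => by
        simp only [MTrm.letterBoxes, List.forall_mem_singleton] at hq
        rw [h.box_mem i (Nat.lt_succ_iff.1 i.isLt) a hq.1 φ hq.2]
        simp only [msemT, labelledWord, WordRel]
        constructor
        · rintro hφ j ⟨hj, ha⟩
          exact hj ▸ hφ ha
        · intro hφ ha
          have hi : (i : ℕ) < w.length := (List.getElem?_eq_some_iff.1 ha).1
          exact hφ ⟨i + 1, by omega⟩ ⟨rfl, ha⟩
    | .comp e f, φ, hq, i => by
        simp only [MTrm.letterBoxes, List.forall_mem_append] at hq
        rw [(h.isMCS i).box_comp, box_mem_iff h e _ hq.1]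
        simp only [box_mem_iff h f φ hq.2, msemT]
        exact ⟨fun H k ⟨j, h₁, h₂⟩ => H j h₁ k h₂, fun H j h₁ k h₂ => H k ⟨j, h₁, h₂⟩⟩
    | .union e f, φ, hq, i => by
        simp only [MTrm.letterBoxes, List.forall_mem_append] at hq
        rw [(h.isMCS i).box_union, box_mem_iff h e _ hq.1, box_mem_iff h f φ hq.2]
        simp only [msemT, or_imp, forall_and]
    | .plus e, φ, hq, i => by
        simp only [MTrm.letterBoxes, List.forall_mem_append] at hq
        have ih₁ := box_mem_iff h e φ hq.1
        have ih₂ := box_mem_iff h e (.box (.plus e) φ) hq.2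
        simp only [msemT]
        constructor
        · intro hφ j hj
          induction hj using Relation.TransGen.head_induction_on with
          | single hj => exact (ih₁ _).1 ((h.isMCS _).box_plus.1 hφ).1 _ hj
          | head hj _ ih => exact ih ((ih₂ _).1 ((h.isMCS _).box_plus.1 hφ).2 _ hj)
        · induction hn : w.length - (i : ℕ) using Nat.strong_induction_on generalizing i with
          | _ n ih =>
            intro hφ
            refine (h.isMCS i).box_plus.2 ⟨(ih₁ i).2 fun j hj => hφ j (.single hj),
              (ih₂ i).2 fun j hj => ih _ ?_ j rfl fun k hk => hφ k (.head hj hk)⟩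
            have := lt_of_msemT (S := labelledWord w Γ) (r := fun j => (j : ℕ))
              (fun _ _ _ h => (labelledWord w Γ).rel_sub _ _ _ h) e hj
            omega
    | .testL ψ e, φ, hq, i => by
        simp only [MTrm.letterBoxes, List.forall_mem_append] at hq
        rw [(h.isMCS i).box_testL, mem_iff_msemF h ψ hq.1, box_mem_iff h e φ hq.2]
        simp only [msemT, and_imp]
        exact ⟨fun H j h₁ h₂ => H h₁ j h₂, fun H h₁ j h₂ => H j h₁ h₂⟩
    | .testR e ψ, φ, hq, i => by
        simp only [MTrm.letterBoxes, List.forall_mem_append] at hq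
        rw [(h.isMCS i).box_testR, box_mem_iff h e _ hq.2]
        simp only [(h.isMCS _).imp_mem, mem_iff_msemF h ψ hq.1, msemT, and_imp]
end

end Truth

theorem mProofDet_of_valid {φ : MFml A P}
    (h : ∀ (W : Type) (S : GStruct A P W), StWordLike S → ∀ x : W, msemF S φ x) :
    MProofDet φ := by
  refine IsMCS.mProofDet_of_forall fun Γ hΓ => ?_
  obtain ⟨w, Γs, hΓs, h0⟩ := hΓ.exists_labelling (φ.letterBoxes.map Prod.fst)
    (φ :: φ.letterBoxes.map Prod.snd)
  have hφ := h _ (labelledWord w Γs) ⟨w, Equiv.refl _, fun _ _ => Iff.rfl, fun _ _ _ => Iff.rfl⟩ 0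
  exact (h0 φ List.mem_cons_self).1 ((mem_iff_msemF hΓs φ (fun q hq =>
    ⟨List.mem_map_of_mem hq, List.mem_cons_of_mem _ (List.mem_map_of_mem hq)⟩) 0).2 hφ)

end IdentityFreePDL

theorem identity_free_pdl_completeness_words {A P : Type} (φ : MFml A P) :
    (∀ (W : Type) (S : GStruct A P W), StWordLike S → ∀ x : W, msemF S φ x) ↔
      MProofDet φ := by
  exact ⟨mProofDet_of_valid, fun h W S hS => msemF_of_mProofDet hS h⟩
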